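/- Let n ≥ 1, let T = C_r ⊗ … ⊗ C₁ be a tensor product of columns with C_i ∈ B(ϖ_{ℓ_i}) and 1 ≤ ℓ₁ ≤ … ≤ ℓ_r ≤ n, and let ℓ ∈ [n] with ℓ ≥ ℓ_r. Then in the type GL_n affine Hecke algebra H, Ψ_T X^{ϖ_ℓ} = Σ_{C ∈ B(ϖ_ℓ)} X^{⃗C} Ψ_{C⊗T}, where ⃗C = Σ_{c∈C} ε_c. -/

import Mathlib

set_option maxHeartbeats 1000000

attribute [local instance] Classical.propDecidable

noncomputable section

namespace HLHecke

/-- The base ring `ℤ[t^{±1}]` of Laurent polynomials. -/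
abbrev HR : Type := LaurentPolynomial ℤ

/-- The parameter `t`. -/
def tt : HR := LaurentPolynomial.T 1

/-! ### The symmetric group on `Fin n` -/

/-- The simple transposition `s_j = (j, j+1)` (junk value `1` if out of range). -/
def sgen (n : ℕ) (j : ℕ) : Equiv.Perm (Fin n) :=
  if h : j + 1 < n then Equiv.swap ⟨j, Nat.lt_of_succ_lt h⟩ ⟨j + 1, h⟩ else 1

/-- The product `s_{i₁} ⋯ s_{i_ℓ}` of a word `l = [i₁, …, i_ℓ]`. -/
def wordProd (n : ℕ) (l : List ℕ) : Equiv.Perm (Fin n) := (l.map (sgen n)).prod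

/-- The action of `S_n` on `ℤⁿ` by permutation of coordinates. -/
def wAct (n : ℕ) (w : Equiv.Perm (Fin n)) (μ : Fin n → ℤ) : Fin n → ℤ := fun i => μ (w⁻¹ i)

/-- The standard inner product on `ℤⁿ`. -/
def ip (n : ℕ) (μ ν : Fin n → ℤ) : ℤ := ∑ i, μ i * ν i

/-- The standard basis vector `ε_i`. -/
def eps (n : ℕ) (i : Fin n) : Fin n → ℤ := fun k => if k = i then 1 else 0

/-- The simple root `α_j = ε_j − ε_{j+1}` (0-indexed: entries `j` and `j+1` of `Fin n`). -/
def alpha (n : ℕ) (j : ℕ) : Fin n → ℤ :=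
  fun i => if (i : ℕ) = j then 1 else if (i : ℕ) = j + 1 then -1 else 0

/-- The fundamental weight `ϖ_k = ε₁ + … + ε_k`. -/
def varpi (n : ℕ) (k : ℕ) : Fin n → ℤ := fun i => if (i : ℕ) < k then 1 else 0

/-- The set of positive roots `R₊`. -/
def Rpos (n : ℕ) (β : Fin n → ℤ) : Prop := ∃ i j : Fin n, i < j ∧ β = eps n i - eps n j

/-- The Coxeter length: minimal length of a word in the simple transpositions. -/
def len (n : ℕ) (w : Equiv.Perm (Fin n)) : ℕ :=
  sInf {k | ∃ l : List ℕ, (∀ j ∈ l, j + 1 < n) ∧ l.length = k ∧ wordProd n l = w}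

/-- A choice of reduced word for `w`. -/
def redWord (n : ℕ) (w : Equiv.Perm (Fin n)) : List ℕ :=
  if h : ∃ l : List ℕ, (∀ j ∈ l, j + 1 < n) ∧ l.length = len n w ∧ wordProd n l = w
  then h.choose else []

/-! ### Columns -/

lemma col_card_le (n : ℕ) (C : Finset (Fin n)) : C.card ≤ n := by
  simpa using Finset.card_le_univ C

/-- The minimal length coset representative `u_C` attached to a column `C`:
it sends `1, …, ℓ` to the entries of `C` in increasing order and `ℓ+1, …, n` to the
entries of the complement of `C` in increasing order. -/
def colPerm (n : ℕ) (C : Finset (Fin n)) : Equiv.Perm (Fin n) :=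
  ((finCongr ((Nat.add_sub_cancel' (col_card_le n C)).symm)).trans
    finSumFinEquiv.symm).trans <|
  ((Equiv.sumCongr (C.orderIsoOfFin rfl).toEquiv
      ((Cᶜ.orderIsoOfFin (by simp [Finset.card_compl])).toEquiv)).trans <|
    (Equiv.sumCongr (Equiv.refl _) (Equiv.subtypeEquivRight (fun x => Finset.mem_compl))).trans
      (Equiv.sumCompl (fun x => x ∈ C)))

/-- The `k`-th smallest entry of a column (0-indexed, as a natural number; junk `0` if
out of range). -/
def nth (n : ℕ) (C : Finset (Fin n)) (k : ℕ) : ℕ := ((C.sort (· ≤ ·)).map Fin.val).getD k 0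

/-- The action of the simple transposition `s_j` on columns. -/
def sCol (n : ℕ) (j : ℕ) (C : Finset (Fin n)) : Finset (Fin n) := C.image (sgen n j)

/-- Semistandardness of the two-column filling `F ⊗ E` (`F` the left column):
entrywise `f_i ≤ e_i`. -/
def pairSS (n : ℕ) (F E : Finset (Fin n)) : Prop := ∀ k < E.card, nth n F k ≤ nth n E k

/-- A filling by columns (leftmost column first) is semistandard iff all adjacent pairs are. -/
def isSSYT (n : ℕ) (L : List (Finset (Fin n))) : Prop := L.Chain' (pairSS n)

/-- The set `B(ϖ_ℓ)` of columns of length `ℓ`. -/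
def colFinset (n : ℕ) (ℓ : ℕ) : Finset (Finset (Fin n)) := Finset.univ.filter fun C => C.card = ℓ

/-- The highest weight column `(1, …, k)`. -/
def hwCol (n : ℕ) (k : ℕ) : Finset (Fin n) := Finset.univ.filter fun x => (x : ℕ) < k

/-- The vector `⃗C ∈ ℤⁿ` attached to a column `C`. -/
def vecOf (n : ℕ) (C : Finset (Fin n)) : Fin n → ℤ := fun i => if i ∈ C then 1 else 0

/-- The sign `σ^j_C`: `-1` if `j ∈ C` and `j+1 ∉ C`, and `+1` otherwise. -/
def sigmaSign (n : ℕ) (j : ℕ) (C : Finset (Fin n)) : ℤ :=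
  if h : j + 1 < n then
    (if (⟨j, Nat.lt_of_succ_lt h⟩ : Fin n) ∈ C ∧ (⟨j + 1, h⟩ : Fin n) ∉ C then -1 else 1)
  else 1

/-! ### Shapes and tableaux -/

/-- The length `λ'_{j+1}` of the `(j+1)`-st column (0-indexed `j`) of the Young diagram
of a partition `λ`. -/
def shapeColLen (n : ℕ) (μ : Fin n → ℤ) (j : ℕ) : ℕ :=
  (Finset.univ.filter fun i : Fin n => (j : ℤ) < μ i).card

/-- The number of columns of the Young diagram of a dominant weight. -/
def numCols (n : ℕ) (μ : Fin n → ℤ) : ℕ := Finset.univ.sup fun i : Fin n => (μ i).toNat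

/-- The highest weight tableau `T⁰_μ`: row `i` is filled with `i`, i.e. its columns are the
highest weight columns. -/
def hwTableau (n : ℕ) (μ : Fin n → ℤ) : List (Finset (Fin n)) :=
  List.ofFn fun j : Fin (numCols n μ) => hwCol n (shapeColLen n μ (j : ℕ))

/-- The content vector of a tableau: `(wtVec T) i` is the number of entries equal to `i`. -/
def wtVec (n : ℕ) (L : List (Finset (Fin n))) : Fin n → ℤ :=
  fun i => ((L.filter fun C => i ∈ C).length : ℤ)

/-! ### Macdonald's ψ statistic -/

/-- Number of entries `≤ i` in the column at position `p` (0-indexed from the left). -/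
def colCount (n : ℕ) (L : List (Finset (Fin n))) (i p : ℕ) : ℕ :=
  ((L.getD p ∅).filter fun x => (x : ℕ) < i).card

/-- The factor `ψ_{T_{≤ i+1}/T_{≤ i}}` of Macdonald's ψ. -/
def stripFactor (n : ℕ) (L : List (Finset (Fin n))) (i : ℕ) : HR :=
  ∏ p ∈ Finset.range L.length,
    if colCount n L (i + 1) p = colCount n L i p ∧
        colCount n L (i + 1) (p + 1) = colCount n L i (p + 1) + 1 then
      1 - tt ^ (colCount n L i p - colCount n L i (p + 1))
    else 1

/-- Macdonald's `ψ_T = ∏_{i=1}^{n-1} ψ_{T_{≤ i+1}/T_{≤ i}}` for a semistandard tableau. -/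
def macPsi (n : ℕ) (L : List (Finset (Fin n))) : HR := ∏ i ∈ Finset.Ico 1 n, stripFactor n L i

/-- Macdonald's tableau statistic, extended by `0` to non-semistandard fillings. -/
def psiT (n : ℕ) (L : List (Finset (Fin n))) : HR := if isSSYT n L then macPsi n L else 0

/-! ### The affine Hecke algebra -/

/-- Generators of the affine Hecke algebra. -/
inductive AGen (n : ℕ) : Type
  | T : ℕ → AGen n
  | X : Fin n → AGen n
  | Xinv : Fin n → AGen n

/-- The free algebra on the generators. -/
abbrev FA (n : ℕ) := FreeAlgebra HR (AGen n)

def fT (n : ℕ) (j : ℕ) : FA n := FreeAlgebra.ι HR (AGen.T j)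
def fX (n : ℕ) (i : Fin n) : FA n := FreeAlgebra.ι HR (AGen.X i)
def fXi (n : ℕ) (i : Fin n) : FA n := FreeAlgebra.ι HR (AGen.Xinv i)

/-- The defining relations of the type `GL_n` affine Hecke algebra. -/
inductive ARel (n : ℕ) : FA n → FA n → Prop
  | junk (j : ℕ) (h : ¬ j + 1 < n) : ARel n (fT n j) 1
  | quad (j : ℕ) (h : j + 1 < n) :
      ARel n (fT n j * fT n j) ((tt - 1) • fT n j + algebraMap HR (FA n) tt)
  | braid (j : ℕ) (h : j + 2 < n) :
      ARel n (fT n j * fT n (j + 1) * fT n j) (fT n (j + 1) * fT n j * fT n (j + 1))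
  | commT (j k : ℕ) (hjk : j + 1 < k) (hk : k + 1 < n) :
      ARel n (fT n j * fT n k) (fT n k * fT n j)
  | commX (i i' : Fin n) : ARel n (fX n i * fX n i') (fX n i' * fX n i)
  | XinvL (i : Fin n) : ARel n (fX n i * fXi n i) 1
  | XinvR (i : Fin n) : ARel n (fXi n i * fX n i) 1
  | TXT (j : ℕ) (h : j + 1 < n) :
      ARel n (fT n j * fX n ⟨j, Nat.lt_of_succ_lt h⟩ * fT n j) (tt • fX n ⟨j + 1, h⟩)
  | TXcomm (j : ℕ) (h : j + 1 < n) (i : Fin n) (hi1 : (i : ℕ) ≠ j) (hi2 : (i : ℕ) ≠ j + 1) :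
      ARel n (fT n j * fX n i) (fX n i * fT n j)

/-- The type `GL_n` affine Hecke algebra. -/
abbrev H (n : ℕ) := RingQuot (ARel n)

/-- The generator `T_j` of the (affine) Hecke algebra. -/
def Tg (n : ℕ) (j : ℕ) : H n := RingQuot.mkAlgHom HR (ARel n) (fT n j)

/-- The generator `X_i`. -/
def Xg (n : ℕ) (i : Fin n) : H n := RingQuot.mkAlgHom HR (ARel n) (fX n i)

/-- The generator `X_i⁻¹`. -/
def Xig (n : ℕ) (i : Fin n) : H n := RingQuot.mkAlgHom HR (ARel n) (fXi n i)

/-- The scalar `t` inside `H`. -/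
def tH (n : ℕ) : H n := algebraMap HR (H n) tt

/-- The scalar `t^k` inside `H`. -/
def tpow (n : ℕ) (k : ℕ) : H n := algebraMap HR (H n) (tt ^ k)

/-- The monomial `X^μ` for `μ ∈ ℤⁿ`. -/
def Xmon (n : ℕ) (μ : Fin n → ℤ) : H n :=
  (List.ofFn fun i : Fin n =>
    if 0 ≤ μ i then Xg n i ^ (μ i).toNat else Xig n i ^ (-μ i).toNat).prod

/-- The product `T_{i₁} ⋯ T_{i_ℓ}` of a word. -/
def TofWord (n : ℕ) (l : List ℕ) : H n := (l.map (Tg n)).prod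

/-- The element `T_w`, defined via a choice of reduced word for `w`. -/
def Tw (n : ℕ) (w : Equiv.Perm (Fin n)) : H n := TofWord n (redWord n w)

/-- The finite Hecke symmetrizer `1₀ = Σ_{w ∈ S_n} T_w`. -/
def one0 (n : ℕ) : H n := ∑ w : Equiv.Perm (Fin n), Tw n w

/-- The stabilizer `S_{n,λ}` as a finset. -/
def stabFinset (n : ℕ) (lam : Fin n → ℤ) : Finset (Equiv.Perm (Fin n)) :=
  Finset.univ.filter fun w => wAct n w lam = lam

/-- The parabolic symmetrizer `1_λ = Σ_{w ∈ S_{n,λ}} T_w`. -/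
def onePara (n : ℕ) (lam : Fin n → ℤ) : H n := ∑ w ∈ stabFinset n lam, Tw n w

/-- The Poincaré polynomial `W_λ(t) = Σ_{w ∈ S_{n,λ}} t^{ℓ(w)}`. -/
def Wlam (n : ℕ) (lam : Fin n → ℤ) : HR := ∑ w ∈ stabFinset n lam, tt ^ len n w

/-- The parabolic subalgebra `H_{n,λ}`, as the span of `{T_w : w ∈ S_{n,λ}}`. -/
def HparaM (n : ℕ) (lam : Fin n → ℤ) : Submodule HR (H n) :=
  Submodule.span HR (Tw n '' {w | wAct n w lam = lam})

/-- The finite Hecke algebra `H_n`, the subalgebra generated by the `T_j`. -/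
def Hfin (n : ℕ) : Subalgebra HR (H n) := Algebra.adjoin HR (Set.range (Tg n))

/-- The coefficient `h_{C, S}` of the parabolic decomposition
`h = Σ_{F ∈ B(ϖ_ℓ)} T_{u_F} h_F` (defined via choice; it is unique). -/
def paraCoeff (n : ℕ) (ℓ : ℕ) (h : H n) (C : Finset (Fin n)) : H n :=
  if hex : ∃ g : Finset (Fin n) → H n,
      (∀ F : Finset (Fin n), F.card = ℓ → g F ∈ HparaM n (varpi n ℓ)) ∧
      h = ∑ F ∈ colFinset n ℓ, Tw n (colPerm n F) * g F
  then hex.choose C else 0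

/-- The elements `Ψ_T` of the finite Hecke algebra, defined by recursion on the columns of `T`
(leftmost column first).  By convention `Ψ` of the empty tableau is `1₀`. -/
def Psi (n : ℕ) : List (Finset (Fin n)) → H n
  | [] => one0 n
  | [C] => tpow n (len n (colPerm n C)) * Ring.inverse (Tw n (colPerm n C)⁻¹) *
      onePara n (varpi n C.card)
  | C :: S => tpow n (len n (colPerm n C)) * Ring.inverse (Tw n (colPerm n C)⁻¹) *
      paraCoeff n C.card (Psi n S) C

end HLHecke
namespace HLHecke

/-- Number of inversions. -/
def inv (n : ℕ) (w : Equiv.Perm (Fin n)) : ℕ :=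
  (Finset.univ.filter fun p : Fin n × Fin n => p.1 < p.2 ∧ w p.2 < w p.1).card

lemma inv_aux (n : ℕ) (w : Equiv.Perm (Fin n)) (p : Fin n × Fin n) :
    p ∈ (Finset.univ.filter fun p : Fin n × Fin n => p.1 < p.2 ∧ w p.2 < w p.1) ↔
      p.1 < p.2 ∧ w p.2 < w p.1 := by
  rw [Finset.mem_filter]; simp

lemma sgen_val (n j : ℕ) (h : j + 1 < n) (i : Fin n) :
    ((sgen n j i : Fin n) : ℕ) = if (i : ℕ) = j then j + 1 else if (i : ℕ) = j + 1 then j else i := by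
  simp only [sgen, h, dif_pos, Equiv.swap_apply_def, Fin.ext_iff]
  split_ifs <;> simp_all

lemma sgen_sq (n j : ℕ) : sgen n j * sgen n j = 1 := by
  unfold sgen; split_ifs <;> simp

lemma sgen_sgen (n j : ℕ) (i : Fin n) : sgen n j (sgen n j i) = i := by
  have := congrArg (fun w => w i) (sgen_sq n j); simpa using this

lemma sgen_inv (n j : ℕ) : (sgen n j)⁻¹ = sgen n j :=
  inv_eq_of_mul_eq_one_left (sgen_sq n j)

lemma sgen_a (n j : ℕ) (h : j + 1 < n) : sgen n j ⟨j, Nat.lt_of_succ_lt h⟩ = ⟨j + 1, h⟩ := by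
  apply Fin.ext; rw [sgen_val n j h]; simp
lemma sgen_b (n j : ℕ) (h : j + 1 < n) : sgen n j ⟨j + 1, h⟩ = ⟨j, Nat.lt_of_succ_lt h⟩ := by
  apply Fin.ext; rw [sgen_val n j h]; simp
lemma sgen_c (n j : ℕ) (h : j + 1 < n) (i : Fin n) (h1 : (i : ℕ) ≠ j) (h2 : (i : ℕ) ≠ j + 1) :
    sgen n j i = i := by
  apply Fin.ext; rw [sgen_val n j h]; simp [h1, h2]

lemma sgen_lt (n j : ℕ) (h : j + 1 < n) (p q : Fin n) (hpq : p < q)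
    (hne : ¬ ((p : ℕ) = j ∧ (q : ℕ) = j + 1)) : sgen n j p < sgen n j q := by
  rw [Fin.lt_def] at *
  rw [sgen_val n j h, sgen_val n j h]
  split_ifs <;> omega

lemma inv_up (n j : ℕ) (h : j + 1 < n) (w : Equiv.Perm (Fin n))
    (hw : w ⟨j, Nat.lt_of_succ_lt h⟩ < w ⟨j + 1, h⟩) : inv n (w * sgen n j) = inv n w + 1 := by
  set ab : Fin n × Fin n := (⟨j, Nat.lt_of_succ_lt h⟩, ⟨j + 1, h⟩) with hab
  have hmem : ab ∈ (Finset.univ.filter fun p : Fin n × Fin n =>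
      p.1 < p.2 ∧ (w * sgen n j) p.2 < (w * sgen n j) p.1) := by
    rw [inv_aux]; simp [hab, sgen_a n j h, sgen_b n j h, hw]
  unfold inv
  rw [← Finset.card_erase_add_one hmem]
  congr 1
  refine Finset.card_nbij' (fun p => (sgen n j p.1, sgen n j p.2))
    (fun p => (sgen n j p.1, sgen n j p.2)) ?_ ?_ ?_ ?_
  · rintro ⟨p, q⟩ hp
    rw [Finset.mem_coe, Finset.mem_erase, inv_aux] at hp
    rw [Finset.mem_coe, inv_aux]
    refine ⟨sgen_lt n j h _ _ hp.2.1 ?_, hp.2.2⟩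
    rintro ⟨h1, h2⟩
    exact hp.1 (Prod.ext (Fin.ext h1) (Fin.ext h2))
  · rintro ⟨p, q⟩ hp
    rw [Finset.mem_coe, inv_aux] at hp
    rw [Finset.mem_coe, Finset.mem_erase, inv_aux]
    simp only [Equiv.Perm.coe_mul, Function.comp_apply, sgen_sgen, hab, ne_eq,
      Prod.mk.injEq] at hp ⊢
    refine and_comm.1 ⟨⟨sgen_lt n j h _ _ hp.1 ?_, hp.2⟩, ?_⟩
    · rintro ⟨h1, h2⟩
      have e1 : p = ⟨j, Nat.lt_of_succ_lt h⟩ := Fin.ext h1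
      have e2 : q = ⟨j + 1, h⟩ := Fin.ext h2
      subst e1 e2
      exact absurd hp.2 (not_lt.2 hw.le)
    · rintro ⟨h1, h2⟩
      have e1 := congrArg (sgen n j) h1
      have e2 := congrArg (sgen n j) h2
      rw [sgen_sgen, sgen_a n j h] at e1
      rw [sgen_sgen, sgen_b n j h] at e2
      subst e1 e2
      have := hp.1
      simp [Fin.lt_def] at this
  · rintro ⟨p, q⟩ _; simp [sgen_sgen]
  · rintro ⟨p, q⟩ _; simp [sgen_sgen]

lemma inv_down (n j : ℕ) (h : j + 1 < n) (w : Equiv.Perm (Fin n))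
    (hw : w ⟨j + 1, h⟩ < w ⟨j, Nat.lt_of_succ_lt h⟩) : inv n (w * sgen n j) + 1 = inv n w := by
  rw [← inv_up n j h (w * sgen n j)]
  · rw [mul_assoc, sgen_sq, mul_one]
  · simpa [sgen_a n j h, sgen_b n j h] using hw

lemma inv_cases (n j : ℕ) (h : j + 1 < n) (w : Equiv.Perm (Fin n)) :
    w ⟨j, Nat.lt_of_succ_lt h⟩ < w ⟨j + 1, h⟩ ∨ w ⟨j + 1, h⟩ < w ⟨j, Nat.lt_of_succ_lt h⟩ := by
  apply lt_or_gt_of_ne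
  intro e
  have := w.injective e
  simp at this

lemma inv_one (n : ℕ) : inv n 1 = 0 := by
  unfold inv
  rw [Finset.card_eq_zero, Finset.filter_eq_empty_iff]
  rintro ⟨p, q⟩ _ ⟨h1, h2⟩
  exact absurd h1 (not_lt.2 (le_of_lt h2))

lemma strictMono_of_no_desc (n : ℕ) (w : Equiv.Perm (Fin n))
    (hw : ∀ j, ∀ h : j + 1 < n, w ⟨j, Nat.lt_of_succ_lt h⟩ < w ⟨j + 1, h⟩) : w = 1 := by
  cases n with
  | zero => exact Subsingleton.elim _ _
  | succ n =>
    have hm : StrictMono w := by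
      rw [Fin.strictMono_iff_lt_succ]
      intro i
      exact hw i (by omega)
    have : (⇑w) = id := by
      apply (StrictMono.range_inj hm strictMono_id).1
      simp [w.surjective.range_eq]
    ext i
    simp [this]

lemma wordProd_append (n : ℕ) (l m : List ℕ) :
    wordProd n (l ++ m) = wordProd n l * wordProd n m := by simp [wordProd]
lemma wordProd_single (n j : ℕ) : wordProd n [j] = sgen n j := by simp [wordProd]
lemma TofWord_append (n : ℕ) (l m : List ℕ) :
    TofWord n (l ++ m) = TofWord n l * TofWord n m := by simp [TofWord]
lemma TofWord_single (n j : ℕ) : TofWord n [j] = Tg n j := by simp [TofWord]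

lemma exists_word (n : ℕ) : ∀ (k : ℕ) (w : Equiv.Perm (Fin n)), inv n w = k →
    ∃ l : List ℕ, (∀ j ∈ l, j + 1 < n) ∧ l.length = inv n w ∧ wordProd n l = w := by
  intro k
  induction k with
  | zero =>
    intro w hw
    have : w = 1 := by
      apply strictMono_of_no_desc
      intro j h
      rcases inv_cases n j h w with h' | h'
      · exact h'
      · have := inv_down n j h w h'
        omega
    subst this
    exact ⟨[], by simp, by simp [hw], by simp [wordProd]⟩
  | succ k ih =>
    intro w hw
    by_cases hd : ∃ j, ∃ h : j + 1 < n, w ⟨j + 1, h⟩ < w ⟨j, Nat.lt_of_succ_lt h⟩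
    · obtain ⟨j, h, hj⟩ := hd
      have h1 := inv_down n j h w hj
      obtain ⟨l, hl, hlen, hp⟩ := ih (w * sgen n j) (by omega)
      refine ⟨l ++ [j], ?_, by simp; omega, ?_⟩
      · intro i hi
        rcases List.mem_append.1 hi with hi | hi
        · exact hl i hi
        · simp at hi; subst hi; exact h
      · rw [wordProd_append, wordProd_single, hp, mul_assoc, sgen_sq, mul_one]
    · push Not at hd
      have : w = 1 := by
        apply strictMono_of_no_desc
        intro j h
        rcases inv_cases n j h w with h' | h'
        · exact h'
        · exact absurd h' (not_lt.2 (hd j h))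
      subst this
      rw [inv_one] at hw
      omega

lemma inv_le (n : ℕ) (l : List ℕ) (hl : ∀ j ∈ l, j + 1 < n) : inv n (wordProd n l) ≤ l.length := by
  induction l using List.reverseRecOn with
  | nil => simp [wordProd, inv_one]
  | append_singleton l j ih =>
    have h := hl j (by simp)
    have := ih (fun i hi => hl i (by simp [hi]))
    rw [wordProd_append, wordProd_single]
    simp only [List.length_append, List.length_singleton]
    rcases inv_cases n j h (wordProd n l) with h' | h'
    · rw [inv_up n j h _ h']; omega
    · have := inv_down n j h _ h'; omega

lemma len_eq (n : ℕ) (w : Equiv.Perm (Fin n)) : len n w = inv n w := by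
  apply le_antisymm
  · exact Nat.sInf_le (exists_word n _ w rfl)
  · have hne : {k | ∃ l : List ℕ, (∀ j ∈ l, j + 1 < n) ∧ l.length = k ∧ wordProd n l = w}.Nonempty :=
      ⟨_, exists_word n _ w rfl⟩
    obtain ⟨l, hl, h1, h2⟩ := Nat.sInf_mem hne
    unfold len
    rw [← h1, ← h2]
    exact inv_le n l hl

lemma redWord_spec (n : ℕ) (w : Equiv.Perm (Fin n)) :
    (∀ j ∈ redWord n w, j + 1 < n) ∧ (redWord n w).length = inv n w ∧ wordProd n (redWord n w) = w := by
  have h : ∃ l : List ℕ, (∀ j ∈ l, j + 1 < n) ∧ l.length = len n w ∧ wordProd n l = w := by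
    rw [len_eq]; exact exists_word n _ w rfl
  unfold redWord
  rw [dif_pos h]
  rw [← len_eq]
  exact h.choose_spec

lemma Tg_quad (n j : ℕ) (h : j + 1 < n) :
    Tg n j * Tg n j = (tt - 1) • Tg n j + algebraMap HR (H n) tt := by
  have := RingQuot.mkAlgHom_rel HR (ARel.quad (n := n) j h)
  simp only [map_mul, map_add, map_smul, AlgHom.commutes] at this
  exact this
lemma Tg_braid (n j : ℕ) (h : j + 2 < n) :
    Tg n j * Tg n (j + 1) * Tg n j = Tg n (j + 1) * Tg n j * Tg n (j + 1) := by
  have := RingQuot.mkAlgHom_rel HR (ARel.braid (n := n) j h)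
  simp only [map_mul] at this
  exact this
lemma Tg_comm (n j k : ℕ) (hjk : j + 1 < k) (hk : k + 1 < n) :
    Tg n j * Tg n k = Tg n k * Tg n j := by
  have := RingQuot.mkAlgHom_rel HR (ARel.commT (n := n) j k hjk hk)
  simp only [map_mul] at this
  exact this
lemma Xg_comm (n : ℕ) (i j : Fin n) : Xg n i * Xg n j = Xg n j * Xg n i := by
  have := RingQuot.mkAlgHom_rel HR (ARel.commX (n := n) i j)
  simp only [map_mul] at this
  exact this
lemma TXT (n j : ℕ) (h : j + 1 < n) :
    Tg n j * Xg n ⟨j, Nat.lt_of_succ_lt h⟩ * Tg n j = tt • Xg n ⟨j + 1, h⟩ := by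
  have := RingQuot.mkAlgHom_rel HR (ARel.TXT (n := n) j h)
  simp only [map_mul, map_smul] at this
  exact this
lemma TXcomm (n j : ℕ) (h : j + 1 < n) (i : Fin n) (hi1 : (i : ℕ) ≠ j) (hi2 : (i : ℕ) ≠ j + 1) :
    Tg n j * Xg n i = Xg n i * Tg n j := by
  have := RingQuot.mkAlgHom_rel HR (ARel.TXcomm (n := n) j h i hi1 hi2)
  simp only [map_mul] at this
  exact this

lemma tt_unit : IsUnit tt := LaurentPolynomial.isUnit_T 1

lemma Tg_unit (n j : ℕ) (h : j + 1 < n) : IsUnit (Tg n j) := by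
  obtain ⟨u, hu⟩ := tt_unit
  have hq := Tg_quad n j h
  have hu2 : (↑u⁻¹ : HR) * tt = 1 := by rw [← hu]; simp
  have e : Tg n j * Tg n j + (1 - tt) • Tg n j = algebraMap HR (H n) tt := by
    rw [hq, add_right_comm, ← add_smul]; simp
  refine ⟨⟨Tg n j, (↑u⁻¹ : HR) • (Tg n j + (1 - tt) • (1 : H n)), ?_, ?_⟩, rfl⟩
  · rw [mul_smul_comm, mul_add, mul_smul_comm, mul_one, e, Algebra.algebraMap_eq_smul_one,
      smul_smul, hu2, one_smul]
  · rw [smul_mul_assoc, add_mul, smul_mul_assoc, one_mul, e, Algebra.algebraMap_eq_smul_one,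
      smul_smul, hu2, one_smul]

lemma sgen_comm (n a b : ℕ) (hab : a + 1 < b) (hb : b + 1 < n) :
    sgen n a * sgen n b = sgen n b * sgen n a := by
  ext i
  simp only [Equiv.Perm.coe_mul, Function.comp_apply, sgen_val n a (by omega), sgen_val n b hb]
  split_ifs <;> omega

lemma sgen_braid (n a : ℕ) (h : a + 2 < n) :
    sgen n a * sgen n (a + 1) * sgen n a = sgen n (a + 1) * sgen n a * sgen n (a + 1) := by
  ext i
  simp only [Equiv.Perm.coe_mul, Function.comp_apply, sgen_val n a (by omega),
    sgen_val n (a + 1) (by omega)]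
  split_ifs <;> omega

/-- Reduced words of length `k` give well-defined elements. -/
def Mat (n k : ℕ) : Prop := ∀ l l' : List ℕ, (∀ j ∈ l, j + 1 < n) → (∀ j ∈ l', j + 1 < n) →
  l.length = k → l'.length = k → wordProd n l = wordProd n l' → inv n (wordProd n l) = k →
  TofWord n l = TofWord n l'

lemma mat_step (n k : ℕ) (ih : Mat n k) (l l' : List ℕ) (a b : ℕ) (hab : a < b)
    (hl : ∀ j ∈ l, j + 1 < n) (hl' : ∀ j ∈ l', j + 1 < n) (hb : b + 1 < n)
    (h1 : l.length = k) (h2 : l'.length = k)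
    (hp : wordProd n l * sgen n a = wordProd n l' * sgen n b)
    (hinv : inv n (wordProd n l * sgen n a) = k + 1) :
    TofWord n l * Tg n a = TofWord n l' * Tg n b := by
  have ha : a + 1 < n := by omega
  set w := wordProd n l * sgen n a with hw
  have hwa : wordProd n l = w * sgen n a := by rw [hw, mul_assoc, sgen_sq, mul_one]
  have hwb : wordProd n l' = w * sgen n b := by rw [hp, mul_assoc, sgen_sq, mul_one]
  have da : w ⟨a + 1, ha⟩ < w ⟨a, Nat.lt_of_succ_lt ha⟩ := by
    rcases inv_cases n a ha w with h' | h'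
    · have h3 := inv_up n a ha w h'
      have h4 := inv_le n l hl
      rw [hwa] at h4
      omega
    · exact h'
  have db : w ⟨b + 1, hb⟩ < w ⟨b, Nat.lt_of_succ_lt hb⟩ := by
    rcases inv_cases n b hb w with h' | h'
    · have h3 := inv_up n b hb w h'
      have h4 := inv_le n l' hl'
      rw [hwb] at h4
      omega
    · exact h'
  have ia := inv_down n a ha w da
  have ib := inv_down n b hb w db
  by_cases hc : a + 1 = b
  · subst hc
    have i2 := inv_down n (a + 1) hb (w * sgen n a) (by
      simp only [Equiv.Perm.coe_mul, Function.comp_apply]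
      rw [sgen_b n a ha, sgen_c n a ha _ (by simp; omega) (by simp)]
      exact db.trans da)
    have i3 := inv_down n a ha (w * sgen n a * sgen n (a + 1)) (by
      simp only [Equiv.Perm.coe_mul, Function.comp_apply]
      rw [sgen_a n (a + 1) hb, sgen_c n (a + 1) hb _ (by simp) (by simp; omega),
        sgen_a n a ha, sgen_c n a ha _ (by simp; omega) (by simp)]
      exact db)
    obtain ⟨m, hm, hm1, hm2⟩ := exists_word n _ (w * sgen n a * sgen n (a + 1) * sgen n a) rfl
    have e1 : wordProd n (m ++ [a, a + 1]) = w * sgen n a := by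
      rw [wordProd_append, hm2]
      simp only [wordProd, List.map_cons, List.map_nil, List.prod_cons, List.prod_nil, mul_one]
      have := sgen_sq n a
      have := sgen_sq n (a + 1)
      calc _ = w * sgen n a * sgen n (a+1) * (sgen n a * sgen n a) * sgen n (a+1) := by group
        _ = w * sgen n a * (sgen n (a+1) * sgen n (a+1)) := by rw [sgen_sq n a]; group
        _ = _ := by rw [sgen_sq, mul_one]
    have e2 : wordProd n (m ++ [a + 1, a]) = w * sgen n (a + 1) := by
      rw [wordProd_append, hm2]
      simp only [wordProd, List.map_cons, List.map_nil, List.prod_cons, List.prod_nil, mul_one]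
      calc _ = w * (sgen n a * sgen n (a+1) * sgen n a) * sgen n (a+1) * sgen n a := by group
        _ = w * sgen n (a+1) * sgen n a * (sgen n (a+1) * sgen n (a+1)) * sgen n a := by
            rw [sgen_braid n a hb]; group
        _ = w * sgen n (a+1) * (sgen n a * sgen n a) := by rw [sgen_sq n (a+1)]; group
        _ = _ := by rw [sgen_sq, mul_one]
    have t1 := ih l (m ++ [a, a + 1]) hl (by
      intro j hj; simp at hj; rcases hj with hj | rfl | rfl
      · exact hm j hj
      · exact ha
      · exact hb) h1 (by simp; omega) (by rw [e1, hwa]) (by rw [hwa]; omega)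
    have t2 := ih l' (m ++ [a + 1, a]) hl' (by
      intro j hj; simp at hj; rcases hj with hj | rfl | rfl
      · exact hm j hj
      · exact hb
      · exact ha) h2 (by simp; omega) (by rw [e2, hwb]) (by rw [hwb]; omega)
    have br := Tg_braid n a hb
    rw [t1, t2, TofWord_append, TofWord_append]
    simp only [TofWord, List.map_cons, List.map_nil, List.prod_cons, List.prod_nil, mul_one]
    simp only [mul_assoc] at br ⊢
    rw [br]
  · have hab2 : a + 1 < b := by omega
    have i2 := inv_down n b hb (w * sgen n a) (by
      simp only [Equiv.Perm.coe_mul, Function.comp_apply]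
      rw [sgen_c n a ha _ (by simp; omega) (by simp; omega),
        sgen_c n a ha _ (by simp; omega) (by simp; omega)]
      exact db)
    obtain ⟨m, hm, hm1, hm2⟩ := exists_word n _ (w * sgen n a * sgen n b) rfl
    have e1 : wordProd n (m ++ [b]) = w * sgen n a := by
      rw [wordProd_append, hm2, wordProd_single, mul_assoc, sgen_sq, mul_one]
    have e2 : wordProd n (m ++ [a]) = w * sgen n b := by
      rw [wordProd_append, hm2, wordProd_single, mul_assoc w, sgen_comm n a b hab2 hb, ← mul_assoc,
        mul_assoc, sgen_sq, mul_one]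
    have t1 := ih l (m ++ [b]) hl (by
      intro j hj; simp at hj; rcases hj with hj | rfl
      · exact hm j hj
      · exact hb) h1 (by simp; omega) (by rw [e1, hwa]) (by rw [hwa]; omega)
    have t2 := ih l' (m ++ [a]) hl' (by
      intro j hj; simp at hj; rcases hj with hj | rfl
      · exact hm j hj
      · exact ha) h2 (by simp; omega) (by rw [e2, hwb]) (by rw [hwb]; omega)
    rw [t1, t2, TofWord_append, TofWord_append, TofWord_single, TofWord_single, mul_assoc,
      mul_assoc, Tg_comm n a b hab2 hb]

lemma matsumoto (n k : ℕ) : Mat n k := by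
  induction k with
  | zero =>
    intro l l' _ _ h1 h2 _ _
    rw [List.length_eq_zero_iff.1 h1, List.length_eq_zero_iff.1 h2]
  | succ k ih =>
    intro l l' hl hl' h1 h2 hp hinv
    rcases List.eq_nil_or_concat l with rfl | ⟨m, a, rfl⟩
    · simp at h1
    rcases List.eq_nil_or_concat l' with rfl | ⟨m', b, rfl⟩
    · simp at h2
    simp only [List.concat_eq_append] at *
    have hm : ∀ j ∈ m, j + 1 < n := fun j hj => hl j (by simp [hj])
    have hm' : ∀ j ∈ m', j + 1 < n := fun j hj => hl' j (by simp [hj])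
    have ha := hl a (by simp)
    have hb := hl' b (by simp)
    simp only [wordProd_append, wordProd_single, List.length_append, List.length_singleton,
      TofWord_append, TofWord_single, Nat.add_right_cancel_iff] at *
    rcases lt_trichotomy a b with hab | hab | hab
    · exact mat_step n k ih m m' a b hab hm hm' hb h1 h2 hp hinv
    · subst hab
      have e := mul_right_cancel hp
      rw [ih m m' hm hm' h1 h2 e]
      rcases inv_cases n a ha (wordProd n m) with h' | h'
      · have := inv_up n a ha _ h'; omega
      · have := inv_down n a ha _ h'
        have := inv_le n m hm
        omega
    · exact (mat_step n k ih m' m b a hab hm' hm ha h2 h1 hp.symm (hp ▸ hinv)).symm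

lemma TofWord_eq (n : ℕ) (l : List ℕ) (hl : ∀ j ∈ l, j + 1 < n)
    (h : inv n (wordProd n l) = l.length) : TofWord n l = Tw n (wordProd n l) := by
  obtain ⟨h1, h2, h3⟩ := redWord_spec n (wordProd n l)
  exact matsumoto n l.length l _ hl h1 rfl (by omega) h3.symm h

lemma Tw_mul_right (n j : ℕ) (h : j + 1 < n) (w : Equiv.Perm (Fin n))
    (hw : w ⟨j, Nat.lt_of_succ_lt h⟩ < w ⟨j + 1, h⟩) : Tw n (w * sgen n j) = Tw n w * Tg n j := by
  obtain ⟨h1, h2, h3⟩ := redWord_spec n w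
  have := TofWord_eq n (redWord n w ++ [j]) (by
    intro i hi; simp at hi; rcases hi with hi | rfl
    · exact h1 i hi
    · exact h) (by
    rw [wordProd_append, h3, wordProd_single, inv_up n j h w hw]; simp [h2])
  rw [wordProd_append, h3, wordProd_single, TofWord_append, TofWord_single] at this
  exact this.symm

lemma inv_inv (n : ℕ) (w : Equiv.Perm (Fin n)) : inv n w⁻¹ = inv n w := by
  unfold inv
  refine Finset.card_nbij' (fun p => (w⁻¹ p.2, w⁻¹ p.1)) (fun p => (w p.2, w p.1)) ?_ ?_ ?_ ?_
  · rintro ⟨p, q⟩ hp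
    rw [Finset.mem_coe, inv_aux] at hp ⊢
    simpa [and_comm] using hp
  · rintro ⟨p, q⟩ hp
    rw [Finset.mem_coe, inv_aux] at hp ⊢
    simpa [and_comm] using hp
  · rintro ⟨p, q⟩ _; simp
  · rintro ⟨p, q⟩ _; simp

lemma inv_up_left (n j : ℕ) (h : j + 1 < n) (w : Equiv.Perm (Fin n))
    (hw : w⁻¹ ⟨j, Nat.lt_of_succ_lt h⟩ < w⁻¹ ⟨j + 1, h⟩) : inv n (sgen n j * w) = inv n w + 1 := by
  rw [← inv_inv, mul_inv_rev, sgen_inv, inv_up n j h _ hw, inv_inv]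

lemma Tw_mul_left (n j : ℕ) (h : j + 1 < n) (w : Equiv.Perm (Fin n))
    (hw : w⁻¹ ⟨j, Nat.lt_of_succ_lt h⟩ < w⁻¹ ⟨j + 1, h⟩) : Tw n (sgen n j * w) = Tg n j * Tw n w := by
  obtain ⟨h1, h2, h3⟩ := redWord_spec n w
  have := TofWord_eq n ([j] ++ redWord n w) (by
    intro i hi; simp at hi; rcases hi with rfl | hi
    · exact h
    · exact h1 i hi) (by
    rw [wordProd_append, h3, wordProd_single, inv_up_left n j h w hw]; simp [h2])
  rw [wordProd_append, h3, wordProd_single, TofWord_append, TofWord_single] at this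
  exact this.symm

lemma Tw_one (n : ℕ) : Tw n 1 = 1 := by
  have := TofWord_eq n [] (by simp) (by simp [wordProd, inv_one])
  simpa [wordProd, TofWord] using this.symm

lemma TofWord_unit (n : ℕ) (l : List ℕ) (hl : ∀ j ∈ l, j + 1 < n) : IsUnit (TofWord n l) := by
  induction l with
  | nil => simp [TofWord]
  | cons a l ih =>
    have : TofWord n (a :: l) = Tg n a * TofWord n l := by simp [TofWord]
    rw [this]
    exact (Tg_unit n a (hl a (by simp))).mul (ih fun j hj => hl j (by simp [hj]))

lemma Tw_unit (n : ℕ) (w : Equiv.Perm (Fin n)) : IsUnit (Tw n w) :=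
  TofWord_unit n _ (redWord_spec n w).1

lemma pm_apply_inv {n : ℕ} (w : Equiv.Perm (Fin n)) (i : Fin n) : w (w⁻¹ i) = i :=
  Equiv.apply_symm_apply w i
lemma pm_inv_apply {n : ℕ} (w : Equiv.Perm (Fin n)) (i : Fin n) : w⁻¹ (w i) = i :=
  Equiv.symm_apply_apply w i

lemma exists_desc (n : ℕ) (w : Equiv.Perm (Fin n)) (hw : w ≠ 1) :
    ∃ j, ∃ h : j + 1 < n, w ⟨j + 1, h⟩ < w ⟨j, Nat.lt_of_succ_lt h⟩ := by
  by_contra hd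
  push Not at hd
  apply hw
  apply strictMono_of_no_desc
  intro j h
  rcases inv_cases n j h w with h' | h'
  · exact h'
  · exact absurd h' (not_lt.2 (hd j h))

lemma pres_induction (n ℓ : ℕ) (P : Equiv.Perm (Fin n) → Prop) (h1 : P 1)
    (hs : ∀ (v : Equiv.Perm (Fin n)) (j : ℕ) (h : j + 1 < n),
      (∀ i, (v i : ℕ) < ℓ ↔ (i : ℕ) < ℓ) → (j < ℓ ↔ j + 1 < ℓ) →
      v ⟨j, Nat.lt_of_succ_lt h⟩ < v ⟨j + 1, h⟩ → P v → P (v * sgen n j)) :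
    ∀ (k : ℕ) (v : Equiv.Perm (Fin n)), inv n v = k → (∀ i, (v i : ℕ) < ℓ ↔ (i : ℕ) < ℓ) → P v := by
  intro k
  induction k with
  | zero =>
    intro v hv _
    by_cases hv1 : v = 1
    · rw [hv1]; exact h1
    · obtain ⟨j, h, hd⟩ := exists_desc n v hv1
      have := inv_down n j h v hd
      omega
  | succ k ih =>
    intro v hv hp
    by_cases hv1 : v = 1
    · rw [hv1]; exact h1
    · obtain ⟨j, h, hd⟩ := exists_desc n v hv1
      have hi := inv_down n j h v hd
      have hj : j < ℓ ↔ j + 1 < ℓ := by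
        refine ⟨fun hj => ?_, fun hj => by omega⟩
        have e1 := (hp ⟨j, Nat.lt_of_succ_lt h⟩).2 hj
        exact (hp ⟨j + 1, h⟩).1 (lt_trans hd e1)
      have hp' : ∀ i, ((v * sgen n j) i : ℕ) < ℓ ↔ (i : ℕ) < ℓ := by
        intro i
        rw [Equiv.Perm.mul_apply, hp, sgen_val n j h]
        split_ifs <;> omega
      have := hs (v * sgen n j) j h hp' hj (by
        simpa [sgen_a n j h, sgen_b n j h] using hd) (ih _ (by omega) hp')
      rwa [mul_assoc, sgen_sq, mul_one] at this

/-- Increasing on the two blocks. -/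
def Blk (n ℓ : ℕ) (u : Equiv.Perm (Fin n)) : Prop :=
  ∀ i j : Fin n, i < j → ((i : ℕ) < ℓ ↔ (j : ℕ) < ℓ) → u i < u j

lemma Tw_block (n ℓ : ℕ) (u v : Equiv.Perm (Fin n)) (hu : Blk n ℓ u)
    (hv : ∀ i, (v i : ℕ) < ℓ ↔ (i : ℕ) < ℓ) : Tw n (u * v) = Tw n u * Tw n v := by
  refine pres_induction n ℓ (fun v => Tw n (u * v) = Tw n u * Tw n v) ?_ ?_ _ v rfl hv
  · simp [Tw_one]
  · intro v j h hp hj hlt ih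
    rw [← mul_assoc, Tw_mul_right n j h (u * v), Tw_mul_right n j h v hlt, ih, mul_assoc]
    rw [Equiv.Perm.mul_apply, Equiv.Perm.mul_apply]
    apply hu _ _ hlt
    rw [hp, hp]
    exact hj

/-- The commutative monoid generated by the `X_i`. -/
def XM (n : ℕ) : Submonoid (H n) := Submonoid.closure (Set.range (Xg n))

lemma XM_comm (n : ℕ) (a b : XM n) : a * b = b * a := by
  have : ∀ x ∈ Set.range (Xg n), ∀ y ∈ Set.range (Xg n), x * y = y * x := by
    rintro _ ⟨i, rfl⟩ _ ⟨j, rfl⟩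
    exact Xg_comm n i j
  exact (Submonoid.isMulCommutative_closure (H n) this).is_comm.comm a b

instance (n : ℕ) : CommMonoid (XM n) :=
  { (inferInstance : Monoid (XM n)) with mul_comm := XM_comm n }

/-- `X_i` in the commutative monoid. -/
def xm (n : ℕ) (i : Fin n) : XM n := ⟨Xg n i, Submonoid.subset_closure ⟨i, rfl⟩⟩

/-- `X^C`. -/
def XC (n : ℕ) (C : Finset (Fin n)) : H n := ((∏ i ∈ C, xm n i : XM n) : H n)

lemma Xmon_vecOf (n : ℕ) (C : Finset (Fin n)) : Xmon n (vecOf n C) = XC n C := by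
  unfold Xmon XC
  have e : ∏ i ∈ C, xm n i = (List.ofFn fun i : Fin n => if i ∈ C then xm n i else 1).prod := by
    rw [List.prod_ofFn, ← Finset.prod_filter]
    congr 1
    ext i; simp
  rw [e]
  have e2 := map_list_prod (XM n).subtype (List.ofFn fun i : Fin n => if i ∈ C then xm n i else 1)
  refine Eq.trans ?_ e2.symm
  rw [List.map_ofFn]
  congr 2
  funext i
  simp only [vecOf, Function.comp]
  by_cases hi : i ∈ C
  · simp [hi, xm]
  · simp [hi]

lemma XC_insert (n : ℕ) (C : Finset (Fin n)) (a : Fin n) (ha : a ∉ C) :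
    XC n (insert a C) = Xg n a * XC n C := by
  unfold XC
  rw [Finset.prod_insert ha]
  rfl

lemma XC_empty (n : ℕ) : XC n ∅ = 1 := by
  unfold XC; simp

lemma XC_comm0 (n j : ℕ) (h : j + 1 < n) (C : Finset (Fin n))
    (h1 : (⟨j, Nat.lt_of_succ_lt h⟩ : Fin n) ∉ C) (h2 : (⟨j + 1, h⟩ : Fin n) ∉ C) :
    Tg n j * XC n C = XC n C * Tg n j := by
  induction C using Finset.induction_on with
  | empty => simp [XC_empty]
  | insert a C ha ih =>
    simp only [Finset.mem_insert, not_or] at h1 h2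
    rw [XC_insert n C a ha, ← mul_assoc, TXcomm n j h a, mul_assoc, ih h1.2 h2.2, mul_assoc]
    · intro e; exact h1.1 (Fin.ext e.symm)
    · intro e; exact h2.1 (Fin.ext e.symm)

lemma tt_cancel (n : ℕ) (x y : H n) (h : tt • x = tt • y) : x = y :=
  (tt_unit.smul_left_cancel).1 h

lemma TXX (n j : ℕ) (h : j + 1 < n) :
    Tg n j * (Xg n ⟨j, Nat.lt_of_succ_lt h⟩ * Xg n ⟨j + 1, h⟩)
      = (Xg n ⟨j, Nat.lt_of_succ_lt h⟩ * Xg n ⟨j + 1, h⟩) * Tg n j := by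
  apply tt_cancel
  have e := TXT n j h
  set x := Xg n ⟨j, Nat.lt_of_succ_lt h⟩
  set y := Xg n ⟨j + 1, h⟩
  have hc : x * y = y * x := Xg_comm n _ _
  calc tt • (Tg n j * (x * y)) = Tg n j * (x * (tt • y)) := by
        rw [mul_smul_comm, mul_smul_comm]
    _ = (Tg n j * x * Tg n j) * x * Tg n j := by rw [← e]; simp only [mul_assoc]
    _ = tt • ((x * y) * Tg n j) := by
        rw [e, smul_mul_assoc, smul_mul_assoc, hc]

lemma XC_comm (n j : ℕ) (h : j + 1 < n) (C : Finset (Fin n))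
    (hC : (⟨j, Nat.lt_of_succ_lt h⟩ : Fin n) ∈ C ↔ (⟨j + 1, h⟩ : Fin n) ∈ C) :
    Tg n j * XC n C = XC n C * Tg n j := by
  by_cases h1 : (⟨j, Nat.lt_of_succ_lt h⟩ : Fin n) ∈ C
  · have h2 := hC.1 h1
    have hne : (⟨j, Nat.lt_of_succ_lt h⟩ : Fin n) ≠ ⟨j + 1, h⟩ := by simp
    set a : Fin n := ⟨j, Nat.lt_of_succ_lt h⟩ with ha
    set b : Fin n := ⟨j + 1, h⟩ with hb
    have e : C = insert a (insert b ((C.erase a).erase b)) := by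
      rw [Finset.insert_erase (Finset.mem_erase.2 ⟨hne.symm, h2⟩), Finset.insert_erase h1]
    rw [e, XC_insert, XC_insert, ← mul_assoc (Xg n a), ← mul_assoc, TXX n j h, mul_assoc, XC_comm0 n j h,
      mul_assoc _ _ (Tg n j)]
    · simp [← ha]
    · simp [← hb]
    · simp
    · simp [hne]
  · exact XC_comm0 n j h C h1 (fun h2 => h1 (hC.2 h2))

lemma varpi_eq (n ℓ : ℕ) (C : Finset (Fin n)) (hC : ∀ i : Fin n, i ∈ C ↔ (i : ℕ) < ℓ) :
    varpi n ℓ = vecOf n C := by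
  funext i
  simp [varpi, vecOf, hC]

lemma Tw_Xvarpi (n ℓ : ℕ) (v : Equiv.Perm (Fin n))
    (hv : ∀ i, (v i : ℕ) < ℓ ↔ (i : ℕ) < ℓ) :
    Tw n v * Xmon n (varpi n ℓ) = Xmon n (varpi n ℓ) * Tw n v := by
  have hC : ∀ i : Fin n, i ∈ hwCol n ℓ ↔ (i : ℕ) < ℓ := by intro i; simp [hwCol]
  rw [varpi_eq n ℓ _ hC, Xmon_vecOf]
  refine pres_induction n ℓ (fun v => Tw n v * XC n (hwCol n ℓ) = XC n (hwCol n ℓ) * Tw n v)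
    ?_ ?_ _ v rfl hv
  · simp [Tw_one]
  · intro v j h hp hj hlt ih
    rw [Tw_mul_right n j h v hlt, mul_assoc, XC_comm n j h, ← mul_assoc, ih, mul_assoc]
    rw [hC, hC]; exact hj

lemma conj_X (n ℓ : ℕ) : ∀ (k : ℕ) (u : Equiv.Perm (Fin n)), inv n u = k → Blk n ℓ u →
    ∀ C : Finset (Fin n), (∀ i, u i ∈ C ↔ (i : ℕ) < ℓ) →
    Tw n u * Xmon n (varpi n ℓ) * Tw n u⁻¹ = tt ^ k • XC n C := by
  intro k
  induction k with
  | zero =>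
    intro u hu hb C hC
    by_cases hu1 : u = 1
    · subst hu1
      rw [varpi_eq n ℓ C hC, Xmon_vecOf]
      simp [Tw_one]
    · obtain ⟨j, h, hd⟩ := exists_desc n u hu1
      have := inv_down n j h u hd
      omega
  | succ k ih =>
    intro u hu hb C hC
    have hu1 : u⁻¹ ≠ 1 := by
      intro h
      rw [inv_eq_one] at h
      rw [h, inv_one] at hu
      omega
    obtain ⟨j, h, hd⟩ := exists_desc n u⁻¹ hu1
    have hi := inv_down n j h u⁻¹ hd
    set a : Fin n := ⟨j, Nat.lt_of_succ_lt h⟩ with ha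
    set b : Fin n := ⟨j + 1, h⟩ with hbb
    have hab : a < b := by simp [ha, hbb, Fin.lt_def]
    set u' := sgen n j * u with hu'
    have huu' : u = sgen n j * u' := by rw [hu', ← mul_assoc, sgen_sq, one_mul]
    have hu'i : u'⁻¹ = u⁻¹ * sgen n j := by rw [hu', mul_inv_rev, sgen_inv]
    have hui : u⁻¹ = u'⁻¹ * sgen n j := by rw [hu'i, mul_assoc, sgen_sq, mul_one]
    have hlt : u'⁻¹ a < u'⁻¹ b := by
      rw [hu'i, Equiv.Perm.mul_apply, Equiv.Perm.mul_apply, ha, hbb, sgen_a n j h, sgen_b n j h]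
      exact hd
    have hnot : ¬ ((((u⁻¹ b : Fin n)) : ℕ) < ℓ ↔ ((u⁻¹ a : Fin n) : ℕ) < ℓ) := by
      intro hh
      have := hb _ _ hd hh
      simp only [pm_apply_inv] at this
      exact absurd this (not_lt.2 hab.le)
    have hCa := hC (u⁻¹ a)
    have hCb := hC (u⁻¹ b)
    rw [pm_apply_inv] at hCa hCb
    have hdv : ((u⁻¹ b : Fin n) : ℕ) < ((u⁻¹ a : Fin n) : ℕ) := hd
    have hbC : b ∈ C := by rw [hCb]; by_contra hc; apply hnot; omega
    have haC : a ∉ C := by rw [hCa]; intro hc; apply hnot; omega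
    have hblk : Blk n ℓ u' := by
      intro p q hpq hs
      rw [hu', Equiv.Perm.mul_apply, Equiv.Perm.mul_apply]
      apply sgen_lt n j h _ _ (hb p q hpq hs)
      rintro ⟨e1, e2⟩
      have e1' : u p = a := Fin.ext e1
      have e2' : u q = b := Fin.ext e2
      rw [← e1', ← e2', pm_inv_apply, pm_inv_apply] at hd
      exact absurd hd (not_lt.2 hpq.le)
    have key := ih u' (by rw [← inv_inv, hu'i]; rw [inv_inv n u] at hi; omega) hblk
      (insert a (C.erase b)) (by
        intro i
        rw [← hC i, hu', Equiv.Perm.mul_apply]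
        generalize u i = x
        by_cases hxa : x = a
        · subst hxa
          rw [ha, sgen_a n j h, ← ha, ← hbb]
          simp [haC, hab.ne']
        · by_cases hxb : x = b
          · subst hxb
            rw [hbb, sgen_b n j h, ← ha, ← hbb]
            simp [hbC]
          · rw [sgen_c n j h x (fun e => hxa (Fin.ext e)) (fun e => hxb (Fin.ext e))]
            simp [hxa, hxb])
    rw [hui, Tw_mul_right n j h _ hlt]
    conv_lhs => rw [huu']
    rw [Tw_mul_left n j h u' hlt]
    have haE : a ∉ C.erase b := fun hh => haC (Finset.mem_of_mem_erase hh)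
    have hbE : b ∉ C.erase b := by simp
    calc Tg n j * Tw n u' * Xmon n (varpi n ℓ) * (Tw n u'⁻¹ * Tg n j)
        = Tg n j * (Tw n u' * Xmon n (varpi n ℓ) * Tw n u'⁻¹) * Tg n j := by
          simp only [mul_assoc]
      _ = tt ^ k • (Tg n j * (Xg n a * XC n (C.erase b)) * Tg n j) := by
          rw [key, XC_insert n _ a haE, mul_smul_comm, smul_mul_assoc]
      _ = tt ^ k • ((Tg n j * Xg n a * Tg n j) * XC n (C.erase b)) := by
          rw [mul_assoc, mul_assoc (Xg n a), ← XC_comm0 n j h _ haE hbE]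
          simp only [mul_assoc]
      _ = tt ^ (k + 1) • XC n C := by
          rw [TXT n j h, smul_mul_assoc, ← XC_insert n _ _ hbE, Finset.insert_erase hbC, smul_smul,
            pow_succ]

lemma colPerm_inl (n : ℕ) (C : Finset (Fin n)) (k : Fin C.card) :
    colPerm n C (Fin.cast (Nat.add_sub_cancel' (col_card_le n C)) (Fin.castAdd _ k)) =
      C.orderEmbOfFin rfl k := by
  simp [colPerm]

lemma colPerm_inr (n : ℕ) (C : Finset (Fin n)) (k : Fin (n - C.card)) :
    colPerm n C (Fin.cast (Nat.add_sub_cancel' (col_card_le n C)) (Fin.natAdd _ k)) =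
      Cᶜ.orderEmbOfFin (by simp [Finset.card_compl]) k := by
  simp [colPerm]

lemma colPerm_cases (n : ℕ) (C : Finset (Fin n)) (i : Fin n) :
    (∃ k : Fin C.card, (i : ℕ) = k ∧ colPerm n C i = C.orderEmbOfFin rfl k) ∨
    (∃ k : Fin (n - C.card), (i : ℕ) = C.card + k ∧
      colPerm n C i = Cᶜ.orderEmbOfFin (by simp [Finset.card_compl]) k) := by
  by_cases h : (i : ℕ) < C.card
  · left
    refine ⟨⟨i, h⟩, rfl, ?_⟩
    rw [← colPerm_inl]
    rfl
  · right
    refine ⟨⟨i - C.card, by have := i.2; omega⟩, by simp; omega, ?_⟩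
    rw [← colPerm_inr]
    congr 1
    apply Fin.ext
    simp
    omega

lemma colPerm_mem (n : ℕ) (C : Finset (Fin n)) (i : Fin n) :
    colPerm n C i ∈ C ↔ (i : ℕ) < C.card := by
  rcases colPerm_cases n C i with ⟨k, h1, h2⟩ | ⟨k, h1, h2⟩
  · rw [h2, h1]
    simp
  · have : colPerm n C i ∈ Cᶜ := by rw [h2]; exact Finset.orderEmbOfFin_mem _ _ _
    rw [Finset.mem_compl] at this
    simp only [this, false_iff]
    omega

lemma colPerm_blk (n : ℕ) (C : Finset (Fin n)) : Blk n C.card (colPerm n C) := by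
  intro i j hij hs
  have hij' : (i : ℕ) < j := hij
  rcases colPerm_cases n C i with ⟨k, h1, h2⟩ | ⟨k, h1, h2⟩ <;>
  rcases colPerm_cases n C j with ⟨m, h3, h4⟩ | ⟨m, h3, h4⟩
  · rw [h2, h4]
    apply (C.orderEmbOfFin rfl).strictMono
    rw [Fin.lt_def]; omega
  · omega
  · omega
  · rw [h2, h4]
    apply (Cᶜ.orderEmbOfFin _).strictMono
    rw [Fin.lt_def]; omega

lemma wAct_iff (n ℓ : ℕ) (v : Equiv.Perm (Fin n)) :
    wAct n v (varpi n ℓ) = varpi n ℓ ↔ ∀ i, (v i : ℕ) < ℓ ↔ (i : ℕ) < ℓ := by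
  constructor
  · intro h i
    have := congrFun h (v i)
    simp only [wAct, varpi, pm_inv_apply] at this
    split_ifs at this <;> first | omega | simp_all
  · intro h
    funext i
    have := h (v⁻¹ i)
    rw [pm_apply_inv] at this
    simp [wAct, varpi, this]

/-- Existence of the parabolic decomposition. -/
def Dec (n ℓ : ℕ) (h : H n) : Prop := ∃ g : Finset (Fin n) → H n,
      (∀ F : Finset (Fin n), F.card = ℓ → g F ∈ HparaM n (varpi n ℓ)) ∧
      h = ∑ F ∈ colFinset n ℓ, Tw n (colPerm n F) * g F

lemma Dec_Tw (n ℓ : ℕ) (hℓ : ℓ ≤ n) (w : Equiv.Perm (Fin n)) : Dec n ℓ (Tw n w) := by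
  set F : Finset (Fin n) := (hwCol n ℓ).map w.toEmbedding with hF
  have hcard : F.card = ℓ := by
    rw [hF, Finset.card_map]
    have := Fin.card_filter_val_lt (n := n) (m := ℓ)
    unfold hwCol
    convert this using 1
    simp [hℓ]
  have hmem : ∀ i, w i ∈ F ↔ (i : ℕ) < ℓ := by
    intro i; simp [hF, hwCol]
  set v := (colPerm n F)⁻¹ * w with hv
  have hpv : ∀ i, (v i : ℕ) < ℓ ↔ (i : ℕ) < ℓ := by
    intro i
    rw [← hmem i]
    have := colPerm_mem n F (v i)
    rw [hcard] at this
    rw [← this, hv, Equiv.Perm.mul_apply, pm_apply_inv]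
  have hb := colPerm_blk n F
  rw [hcard] at hb
  have e := Tw_block n ℓ _ v hb hpv
  rw [hv, mul_inv_cancel_left, ← hv] at e
  refine ⟨fun E => if E = F then Tw n v else 0, ?_, ?_⟩
  · intro E _
    dsimp only
    split_ifs
    · exact Submodule.subset_span ⟨v, (wAct_iff n ℓ v).2 hpv, rfl⟩
    · exact Submodule.zero_mem _
  · rw [e, Finset.sum_eq_single F]
    · simp
    · intro E _ hne; simp [hne]
    · intro hh; exact absurd (by simp [colFinset, hcard]) hh

/-- The span of the `T_w`. -/
def WS (n : ℕ) : Submodule HR (H n) := Submodule.span HR (Set.range (Tw n))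

lemma Dec_WS (n ℓ : ℕ) (hℓ : ℓ ≤ n) (x : H n) (hx : x ∈ WS n) : Dec n ℓ x := by
  induction hx using Submodule.span_induction with
  | mem x hx => obtain ⟨w, rfl⟩ := hx; exact Dec_Tw n ℓ hℓ w
  | zero => exact ⟨fun _ => 0, fun _ _ => Submodule.zero_mem _, by simp⟩
  | add x y _ _ hx hy =>
    obtain ⟨g, hg, rfl⟩ := hx
    obtain ⟨g', hg', rfl⟩ := hy
    exact ⟨fun F => g F + g' F, fun F hF => Submodule.add_mem _ (hg F hF) (hg' F hF), by
      rw [← Finset.sum_add_distrib]; simp only [mul_add]⟩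
  | smul r x _ hx =>
    obtain ⟨g, hg, rfl⟩ := hx
    exact ⟨fun F => r • g F, fun F hF => Submodule.smul_mem _ _ (hg F hF), by
      rw [Finset.smul_sum]; simp only [mul_smul_comm]⟩

lemma Tw_mem (n : ℕ) (w : Equiv.Perm (Fin n)) : Tw n w ∈ WS n := Submodule.subset_span ⟨w, rfl⟩

lemma Tg_WS (n j : ℕ) (h : j + 1 < n) (x : H n) (hx : x ∈ WS n) : Tg n j * x ∈ WS n := by
  induction hx using Submodule.span_induction with
  | mem x hx =>
    obtain ⟨w, rfl⟩ := hx
    rcases inv_cases n j h w⁻¹ with h' | h'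
    · rw [← Tw_mul_left n j h w h']; exact Tw_mem n _
    · have e := Tw_mul_left n j h (sgen n j * w) (by
        simpa [sgen_inv, sgen_a n j h, sgen_b n j h] using h')
      rw [← mul_assoc, sgen_sq, one_mul] at e
      rw [e, ← mul_assoc, Tg_quad n j h, add_mul, smul_mul_assoc, ← e, ← Algebra.smul_def]
      exact Submodule.add_mem _ (Submodule.smul_mem _ _ (Tw_mem n _))
        (Submodule.smul_mem _ _ (Tw_mem n _))
  | zero => rw [mul_zero]; exact Submodule.zero_mem _
  | add x y _ _ hx hy => rw [mul_add]; exact Submodule.add_mem _ hx hy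
  | smul r x _ hx => rw [mul_smul_comm]; exact Submodule.smul_mem _ _ hx

lemma Tg_inv (n j : ℕ) (h : j + 1 < n) (x : H n) (hx : x ∈ WS n) :
    Ring.inverse (Tg n j) * x ∈ WS n := by
  obtain ⟨u, hu⟩ := tt_unit
  have hu2 : (↑u⁻¹ : HR) * tt = 1 := by rw [← hu]; simp
  have e : Tg n j * Tg n j + (1 - tt) • Tg n j = algebraMap HR (H n) tt := by
    rw [Tg_quad n j h, add_right_comm, ← add_smul]; simp
  have e2 : Ring.inverse (Tg n j) * x
      = (↑u⁻¹ : HR) • (Tg n j * x + (1 - tt) • x) := by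
    have e3 : x = Tg n j * ((↑u⁻¹ : HR) • (Tg n j * x + (1 - tt) • x)) := by
      rw [mul_smul_comm, mul_add, mul_smul_comm, ← mul_assoc, ← smul_mul_assoc, ← add_mul, e,
        ← Algebra.smul_def, smul_smul, hu2, one_smul]
    conv_lhs => rw [e3]
    rw [Ring.inverse_mul_cancel_left _ _ (Tg_unit n j h)]
  rw [e2]
  exact Submodule.smul_mem _ _ (Submodule.add_mem _ (Tg_WS n j h x hx) (Submodule.smul_mem _ _ hx))

lemma TofWord_inv (n : ℕ) (l : List ℕ) (hl : ∀ j ∈ l, j + 1 < n) : ∀ x ∈ WS n,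
    Ring.inverse (TofWord n l) * x ∈ WS n := by
  induction l with
  | nil => intro x hx; simpa [TofWord] using hx
  | cons a l ih =>
    intro x hx
    have e : TofWord n (a :: l) = Tg n a * TofWord n l := by simp [TofWord]
    have ha := hl a (by simp)
    have hl' : ∀ j ∈ l, j + 1 < n := fun j hj => hl j (by simp [hj])
    have e2 : Ring.inverse (TofWord n (a :: l)) * x
        = Ring.inverse (TofWord n l) * (Ring.inverse (Tg n a) * x) := by
      have hu := TofWord_unit n l hl'
      have hv := Tg_unit n a ha
      have hw := TofWord_unit n _ hl
      apply hw.mul_left_cancel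
      rw [Ring.mul_inverse_cancel_left _ _ hw, e, mul_assoc, Ring.mul_inverse_cancel_left _ _ hu,
        Ring.mul_inverse_cancel_left _ _ hv]
    rw [e2]
    exact ih hl' _ (Tg_inv n a ha x hx)

lemma pre_WS (n k : ℕ) (w : Equiv.Perm (Fin n)) (x : H n) (hx : x ∈ WS n) :
    tpow n k * Ring.inverse (Tw n w) * x ∈ WS n := by
  rw [mul_assoc, tpow, ← Algebra.smul_def]
  exact Submodule.smul_mem _ _ (TofWord_inv n _ (redWord_spec n w).1 x hx)

lemma Hpara_WS (n ℓ : ℕ) : HparaM n (varpi n ℓ) ≤ WS n :=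
  Submodule.span_mono (by rintro _ ⟨w, _, rfl⟩; exact ⟨w, rfl⟩)

lemma paraCoeff_WS (n : ℕ) (h : H n) (C : Finset (Fin n)) : paraCoeff n C.card h C ∈ WS n := by
  unfold paraCoeff
  split_ifs with hex
  · exact Hpara_WS n _ (hex.choose_spec.1 C rfl)
  · exact Submodule.zero_mem _

lemma Psi_WS (n : ℕ) (L : List (Finset (Fin n))) : Psi n L ∈ WS n := by
  match L with
  | [] => exact Submodule.sum_mem _ fun w _ => Tw_mem n w
  | [C] => exact pre_WS n _ _ _ (Submodule.sum_mem _ fun w _ => Tw_mem n w)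
  | C :: D :: S => exact pre_WS n _ _ _ (paraCoeff_WS n _ C)

lemma Hpara_comm (n ℓ : ℕ) (g : H n) (hg : g ∈ HparaM n (varpi n ℓ)) :
    g * Xmon n (varpi n ℓ) = Xmon n (varpi n ℓ) * g := by
  induction hg using Submodule.span_induction with
  | mem x hx =>
    obtain ⟨w, hw, rfl⟩ := hx
    exact Tw_Xvarpi n ℓ w ((wAct_iff n ℓ w).1 hw)
  | zero => simp
  | add x y _ _ hx hy => rw [mul_add, add_mul, hx, hy]
  | smul r x _ hx => rw [mul_smul_comm, smul_mul_assoc, hx]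

lemma Tu_X (n : ℕ) (C : Finset (Fin n)) :
    Tw n (colPerm n C) * Xmon n (varpi n C.card) = Xmon n (vecOf n C) *
      (tpow n (len n (colPerm n C)) * Ring.inverse (Tw n (colPerm n C)⁻¹)) := by
  have e := conj_X n C.card _ (colPerm n C) rfl (colPerm_blk n C) C (colPerm_mem n C)
  have hu := Tw_unit n (colPerm n C)⁻¹
  apply hu.mul_right_cancel
  rw [e, Xmon_vecOf, mul_assoc, mul_assoc, Ring.inverse_mul_cancel _ hu, mul_one, tpow, len_eq,
    ← Algebra.commutes, Algebra.smul_def]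

/-- `Ψ_T X^{ϖ_ℓ} = Σ_{C ∈ B(ϖ_ℓ)} X^{⃗C} Ψ_{C ⊗ T}` in the affine Hecke
algebra, for `T = C_r ⊗ … ⊗ C₁` with column lengths `1 ≤ ℓ₁ ≤ … ≤ ℓ_r ≤ ℓ ≤ n`. -/
theorem stmt11 (n : ℕ) (hn : 1 ≤ n) (L : List (Finset (Fin n))) (hne : L ≠ [])
    (hcards : L.Chain' fun A B => B.card ≤ A.card)
    (hpos : ∀ C ∈ L, 1 ≤ C.card)
    (ℓ : ℕ) (h1 : 1 ≤ ℓ) (hℓn : ℓ ≤ n)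
    (hhead : ∀ C ∈ L.head?, C.card ≤ ℓ) :
    Psi n L * Xmon n (varpi n ℓ)
      = ∑ C ∈ colFinset n ℓ, Xmon n (vecOf n C) * Psi n (C :: L) := by
  obtain ⟨D, S, rfl⟩ : ∃ D S, L = D :: S := by
    cases L with
    | nil => exact absurd rfl hne
    | cons D S => exact ⟨D, S, rfl⟩
  have hex : Dec n ℓ (Psi n (D :: S)) := Dec_WS n ℓ hℓn _ (Psi_WS n _)
  have hP : ∀ C ∈ colFinset n ℓ, Psi n (C :: D :: S) =
      tpow n (len n (colPerm n C)) * Ring.inverse (Tw n (colPerm n C)⁻¹) *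
        Exists.choose hex C := by
    intro C hC
    have hc : C.card = ℓ := by simpa [colFinset] using hC
    have e : paraCoeff n C.card (Psi n (D :: S)) C = Exists.choose hex C := by
      rw [hc]
      unfold paraCoeff
      exact dif_pos hex
    rw [← e, Psi]
    simp
  rw [Finset.sum_congr rfl fun C hC => by rw [hP C hC]]
  have hs := Exists.choose_spec hex
  set g := Exists.choose hex
  conv_lhs => rw [hs.2]
  rw [Finset.sum_mul]
  refine Finset.sum_congr rfl fun C hC => ?_
  have hc : C.card = ℓ := by simpa [colFinset] using hC
  rw [mul_assoc, Hpara_comm n ℓ _ (hs.1 C hc), ← mul_assoc, ← mul_assoc, ← Tu_X, hc]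

end HLHecke
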